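/- Fix positive integers n, ñ, k with ñ ≤ n. For every Path_k-join tree T and every Path_k-pathset A (with respect to n and ñ), χ_T(A) ≥ ñ^{Ψ(T)} · μ(A). -/

import Mathlib

noncomputable section

/-- A finite subgraph of the infinite path `Path_ℤ`, identified with its (finite) edge set:
the integer `i` encodes the edge `{i-1, i}` of `Path_ℤ`. -/
abbrev PGraph := Finset ℤ

/-- The connected component of the edge `i` in `G`: all edges `j ∈ G` such that every edge
lying between `i` and `j` also belongs to `G`. -/
def comp (G : PGraph) (i : ℤ) : PGraph :=
  G.filter fun j => ∀ l ∈ Finset.Icc (min i j) (max i j), l ∈ G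

/-- `Δ(G)`: the number of connected components of `G`. -/
def Delta (G : PGraph) : ℕ := (G.filter fun i => i - 1 ∉ G).card

/-- `λ(G)`: the maximum number of edges of a connected component of `G`. -/
def lam (G : PGraph) : ℕ := G.sup fun i => (comp G i).card

/-- `G ⊖ F`: the union of the connected components of `G` that are vertex-disjoint from `F`.
(The edges `{i-1,i}` and `{f-1,f}` share a vertex iff `|i - f| ≤ 1`.) -/
def ominus (G F : PGraph) : PGraph :=
  G.filter fun i => ∀ j ∈ comp G i, ∀ f ∈ F, 1 < (j - f).natAbs

/-- `Path_k`: the subgraph of `Path_ℤ` with edges `{i-1,i}` for `1 ≤ i ≤ k`. -/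
def pathk (k : ℕ) : PGraph := Finset.Icc 1 (k : ℤ)

/-- `Δ⃗(G_1,…,G_m ∣ F)`. -/
def dvecFrom : PGraph → List PGraph → ℕ
  | _, [] => 0
  | F, G :: L => Delta (ominus G F) + dvecFrom (F ∪ G) L

/-- `Δ⃗(G_1,…,G_m)`. -/
def dvec (L : List PGraph) : ℕ := dvecFrom ∅ L

def lvecFrom : PGraph → List PGraph → ℕ
  | _, [] => 0
  | F, G :: L => lam (ominus G F) + lvecFrom (F ∪ G) L

/-- `λ⃗(G_1,…,G_m)`. -/
def lvec (L : List PGraph) : ℕ := lvecFrom ∅ L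

def ldvecFrom : PGraph → List PGraph → ℕ
  | _, [] => 0
  | F, G :: L => lam (ominus G F) * Delta (ominus G F) + ldvecFrom (F ∪ G) L

/-- `λΔ⃗(G_1,…,G_m)`. -/
def ldvec (L : List PGraph) : ℕ := ldvecFrom ∅ L

/-- The sequence `G_1, …, G_m` as a list. -/
def seqList {m : ℕ} (G : Fin m → PGraph) : List PGraph := (List.finRange m).map G

/-- `G_1 ∪ ⋯ ∪ G_{j-1}` (the union of the entries strictly before `j`). -/
def unionBelow {m : ℕ} (G : Fin m → PGraph) (j : Fin m) : PGraph :=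
  (Finset.univ.filter fun i => i < j).biUnion G

/-- A shift permutation: `σ(j) ≥ j - 1` for all `j`. -/
def IsShiftPerm {m : ℕ} (σ : Equiv.Perm (Fin m)) : Prop :=
  ∀ j : Fin m, (j : ℕ) ≤ (σ j : ℕ) + 1
/-- Join trees: finite binary trees whose leaves are labelled by subgraphs of `Path_ℤ`. -/
inductive JoinTree where
  | leaf : PGraph → JoinTree
  | node : JoinTree → JoinTree → JoinTree

namespace JoinTree

/-- The graph labelling a node (the label of an internal node is the union of the labels
of its children). -/
def graph : JoinTree → PGraph
  | leaf G => G
  | node T₁ T₂ => T₁.graph ∪ T₂.graph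

/-- A join tree is valid if each leaf is labelled by a single-edge graph or by `∅`. -/
def valid : JoinTree → Prop
  | leaf G => G.card ≤ 1
  | node T₁ T₂ => T₁.valid ∧ T₂.valid

/-- The lists `B_1, …, B_ℓ` of sibling labels (top to bottom, ending with the leaf label)
along each root-to-leaf branch. -/
def branches : JoinTree → List (List PGraph)
  | leaf G => [[G]]
  | node T₁ T₂ =>
    ((branches T₁).map fun b => T₂.graph :: b) ++ ((branches T₂).map fun b => T₁.graph :: b)

end JoinTree

/-- `Ψ(T)`: the maximum of `Δ⃗(C_1,…,C_r)` over all `T`-branch coverings `{C_1,…,C_r}` of the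
root graph and all enumerations `C_1,…,C_r` of them. -/
def Psi (T : JoinTree) : ℕ :=
  (T.branches.map fun b => ((b.dedup.permutations).map dvec).foldr max 0).foldr max 0

/-- `[T_1,…,T_m] = T_1 ∪ [T_2,…,T_m]`. -/
def sqComb : (m : ℕ) → (Fin (m + 1) → JoinTree) → JoinTree
  | 0, T => T 0
  | m + 1, T => JoinTree.node (T 0) (sqComb m fun i => T i.succ)

/-- `⟦T_1,…,T_m⟧ = ⟦T_1,…,T_{m-1}⟧ ∪ ⟦T_1,…,T_{m-2},T_m⟧`. -/
def semComb : (m : ℕ) → (Fin (m + 1) → JoinTree) → JoinTree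
  | 0, T => T 0
  | m + 1, T =>
    JoinTree.node (semComb m fun i => T i.castSucc)
      (semComb m fun i => if (i : ℕ) = m then T (Fin.last (m + 1)) else T i.castSucc)

/-- `T` is expressible by nesting `[·]` operations to depth `≤ d`, starting from
single-node join trees. -/
inductive SqDepthLE : ℕ → JoinTree → Prop
  | base (d : ℕ) (G : PGraph) : SqDepthLE d (JoinTree.leaf G)
  | step (d m : ℕ) (T : Fin (m + 1) → JoinTree) (h : ∀ i, SqDepthLE d (T i)) :
      SqDepthLE (d + 1) (sqComb m T)

/-- The `[·]`-depth of a join tree: the minimum nesting depth of `[·]` operations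
required to express it. -/
def sqDepth (T : JoinTree) : ℕ := sInf {d | SqDepthLE d T}

/-- `T` is expressible by nesting `⟦·⟧` operations to depth `≤ d`, starting from
single-node join trees. -/
inductive SemDepthLE : ℕ → JoinTree → Prop
  | base (d : ℕ) (G : PGraph) : SemDepthLE d (JoinTree.leaf G)
  | step (d m : ℕ) (T : Fin (m + 1) → JoinTree) (h : ∀ i, SemDepthLE d (T i)) :
      SemDepthLE (d + 1) (semComb m T)

/-- The `⟦·⟧`-depth of a join tree: the minimum nesting depth of `⟦·⟧` operations
required to express it. -/
def semDepth (T : JoinTree) : ℕ := sInf {d | SemDepthLE d T}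

open Classical

/-- The vertex set of a graph `G ⊂ Path_ℤ` (the edge `i` has endpoints `i-1` and `i`). -/
def verts (G : PGraph) : Finset ℤ := G ∪ G.image fun i => i - 1

/-- `μ(A)`: the density of a `G`-relation `A ⊆ [n]^{V(G)}`. -/
def mu (n : ℕ) (G : PGraph) (A : Finset (↥(verts G) → Fin n)) : ℝ :=
  (A.card : ℝ) / (n : ℝ) ^ (verts G).card

/-- `μ(A ∣ F)`: the maximum density of `A` conditioned on `F`. -/
def muCond (n : ℕ) (G F : PGraph) (A : Finset (↥(verts G) → Fin n)) : ℝ :=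
  ⨆ β : ↥(verts F) → Fin n,
    ((A.filter fun α => ∀ (v : ℤ) (hG : v ∈ verts G) (hF : v ∈ verts F),
        α ⟨v, hG⟩ = β ⟨v, hF⟩).card : ℝ) / (n : ℝ) ^ (verts G \ verts F).card

/-- A `G`-pathset with respect to the parameters `n` and `ñ`:
`μ(A ∣ F) ≤ (1/ñ)^{Δ(G ⊖ F)}` for every `F ⊆ Path_k`. -/
def IsPathset (n ntil k : ℕ) (G : PGraph) (A : Finset (↥(verts G) → Fin n)) : Prop :=
  ∀ F : PGraph, F ⊆ pathk k → muCond n G F A ≤ (1 / (ntil : ℝ)) ^ Delta (ominus G F)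

theorem verts_mono {G H : PGraph} (h : G ⊆ H) : verts G ⊆ verts H :=
  Finset.union_subset_union h (Finset.image_subset_image h)

/-- The join `A ⋈ B` of a `G`-relation and an `H`-relation. -/
def joinRel (n : ℕ) (G H : PGraph) (A : Finset (↥(verts G) → Fin n))
    (B : Finset (↥(verts H) → Fin n)) :
    Finset (↥(verts (G ∪ H)) → Fin n) :=
  Finset.univ.filter fun γ =>
    (fun v : ↥(verts G) =>
        γ ⟨v.1, verts_mono Finset.subset_union_left v.2⟩) ∈ A ∧
    (fun v : ↥(verts H) =>
        γ ⟨v.1, verts_mono Finset.subset_union_right v.2⟩) ∈ B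

/-- Pathset complexity `χ_T(A)`. -/
def chi (n ntil k : ℕ) : (T : JoinTree) → Finset (↥(verts T.graph) → Fin n) → ℕ
  | .leaf G, A => if G = ∅ ∨ A = ∅ then 0 else 1
  | .node T₁ T₂, A =>
    sInf {s : ℕ |
      ∃ (r : ℕ) (Ai : Fin r → Finset (↥(verts (T₁.graph ∪ T₂.graph)) → Fin n))
        (Bi : Fin r → Finset (↥(verts T₁.graph) → Fin n))
        (Ci : Fin r → Finset (↥(verts T₂.graph) → Fin n)),
        (∀ i, IsPathset n ntil k (T₁.graph ∪ T₂.graph) (Ai i)) ∧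
        (∀ i, IsPathset n ntil k T₁.graph (Bi i)) ∧
        (∀ i, IsPathset n ntil k T₂.graph (Ci i)) ∧
        (∀ i, Ai i ⊆ joinRel n T₁.graph T₂.graph (Bi i) (Ci i)) ∧
        (A ⊆ Finset.univ.biUnion Ai) ∧
        s = ∑ i, max (chi n ntil k T₁ (Bi i)) (chi n ntil k T₂ (Ci i))}

/-- The total assignments `ℤ → [n]` whose restriction to `V(G)` lies in the `G`-relation `D`. -/
def cylinder (n : ℕ) (G : PGraph) (D : Finset (↥(verts G) → Fin n)) : Set (ℤ → Fin n) :=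
  {γ | (fun v : ↥(verts G) => γ v.1) ∈ D}

/-- The total assignments that agree with `γ₀` outside the finite set `U`. -/
def agreeOff {n : ℕ} (U : Finset ℤ) (γ₀ : ℤ → Fin n) : Set (ℤ → Fin n) :=
  {γ | ∀ v ∉ U, γ v = γ₀ v}

/-- Every graph `G` in the list `L` carries a `G`-pathset whose cylinder contains `X`. -/
def PathsetBounded (n ntil k : ℕ) (L : List PGraph) (X : Set (ℤ → Fin n)) : Prop :=
  ∀ G ∈ L, ∃ D : Finset (↥(verts G) → Fin n), IsPathset n ntil k G D ∧ X ⊆ cylinder n G D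

theorem verts_union (G H : PGraph) : verts (G ∪ H) = verts G ∪ verts H := by
  ext v
  simp only [verts, Finset.mem_union, Finset.mem_image]
  grind

theorem verts_empty : verts ∅ = ∅ := by simp [verts]

theorem Delta_ominus_le (G F : PGraph) :
    Delta (ominus G F) ≤ (verts G \ verts F).card := by
  refine Finset.card_le_card fun i hi => ?_
  simp only [ominus, Finset.mem_filter] at hi
  obtain ⟨⟨hiG, hi⟩, -⟩ := hi
  have hc : i ∈ comp G i := by
    simp only [comp, Finset.mem_filter, min_self, max_self, Finset.Icc_self,
      Finset.mem_singleton]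
    exact ⟨hiG, fun l hl => hl ▸ hiG⟩
  simp only [verts, Finset.mem_sdiff, Finset.mem_union, Finset.mem_image]
  refine ⟨Or.inl hiG, ?_⟩
  rintro (h | ⟨f, hf, rfl⟩)
  · have := hi i hc i h
    omega
  · have := hi _ hc f hf
    omega

theorem isPathset_singleton {n ntil : ℕ} (k : ℕ) (hntil : 0 < ntil) (hle : ntil ≤ n)
    (G : PGraph) (α : ↥(verts G) → Fin n) : IsPathset n ntil k G {α} := by
  intro F _
  have h1 : (1 : ℝ) ≤ ntil := by exact_mod_cast hntil
  have h2 : (ntil : ℝ) ≤ n := by exact_mod_cast hle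
  refine Real.iSup_le (fun β => ?_) (by positivity)
  calc _ ≤ (1 : ℝ) / (n : ℝ) ^ (verts G \ verts F).card := by
        gcongr
        exact_mod_cast (Finset.card_filter_le _ _).trans (by simp)
    _ = (1 / (n : ℝ)) ^ (verts G \ verts F).card := by rw [one_div_pow]
    _ ≤ (1 / (ntil : ℝ)) ^ (verts G \ verts F).card := by gcongr
    _ ≤ _ := pow_le_pow_of_le_one (by positivity)
        (by rw [div_le_one (by positivity)]; exact h1) (Delta_ominus_le G F)

theorem mem_of_eq_sInf {S : Set ℕ} {m : ℕ} (h : m = sInf S) (hS : S.Nonempty) : m ∈ S :=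
  h ▸ Nat.sInf_mem hS

theorem chi_node_witness {n ntil : ℕ} (k : ℕ) (hntil : 0 < ntil) (hle : ntil ≤ n)
    (T₁ T₂ : JoinTree) (A : Finset (↥(verts (T₁.graph ∪ T₂.graph)) → Fin n)) :
    ∃ (r : ℕ) (Ai : Fin r → Finset (↥(verts (T₁.graph ∪ T₂.graph)) → Fin n))
      (Bi : Fin r → Finset (↥(verts T₁.graph) → Fin n))
      (Ci : Fin r → Finset (↥(verts T₂.graph) → Fin n)),
      (∀ i, IsPathset n ntil k (T₁.graph ∪ T₂.graph) (Ai i)) ∧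
      (∀ i, IsPathset n ntil k T₁.graph (Bi i)) ∧
      (∀ i, IsPathset n ntil k T₂.graph (Ci i)) ∧
      (∀ i, Ai i ⊆ joinRel n T₁.graph T₂.graph (Bi i) (Ci i)) ∧
      (A ⊆ Finset.univ.biUnion Ai) ∧
      chi n ntil k (.node T₁ T₂) A =
        ∑ i, max (chi n ntil k T₁ (Bi i)) (chi n ntil k T₂ (Ci i)) := by
  have hmem := mem_of_eq_sInf (chi.eq_2 n ntil k T₁ T₂ A)
  apply hmem
  let e := A.equivFin.symm
  refine ⟨_, A.card, fun i => {(e i).1},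
    fun i => {fun v => (e i).1 ⟨v.1, verts_mono Finset.subset_union_left v.2⟩},
    fun i => {fun v => (e i).1 ⟨v.1, verts_mono Finset.subset_union_right v.2⟩},
    fun i => isPathset_singleton k hntil hle _ _,
    fun i => isPathset_singleton k hntil hle _ _, fun i => isPathset_singleton k hntil hle _ _,
    fun i => ?_, fun α hα => ?_, rfl⟩
  · rw [Finset.singleton_subset_iff]
    simp [joinRel]
  · exact Finset.mem_biUnion.2 ⟨e.symm ⟨α, hα⟩, Finset.mem_univ _,
      Finset.mem_singleton.2 (congrArg Subtype.val (e.apply_symm_apply ⟨α, hα⟩)).symm⟩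

theorem one_le_chi {n ntil : ℕ} (k : ℕ) (hntil : 0 < ntil) (hle : ntil ≤ n) (T : JoinTree)
    (hT : T.graph ≠ ∅) (A : Finset (↥(verts T.graph) → Fin n)) (hA : A.Nonempty) :
    1 ≤ chi n ntil k T A := by
  induction T with
  | leaf G =>
    have hG : G ≠ ∅ := hT
    simp [chi, hG, hA.ne_empty]
  | node T₁ T₂ ih₁ ih₂ =>
    obtain ⟨r, Ai, Bi, Ci, -, -, -, hJ, hcov, hchi⟩ := chi_node_witness k hntil hle T₁ T₂ A
    rw [hchi]
    obtain ⟨α, hα⟩ := hA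
    obtain ⟨i, -, hi⟩ := Finset.mem_biUnion.1 (hcov hα)
    have hj := (Finset.mem_filter.1 (hJ i hi)).2
    refine le_trans ?_ (Finset.single_le_sum (f := fun i =>
      max (chi n ntil k T₁ (Bi i)) (chi n ntil k T₂ (Ci i))) (fun _ _ => Nat.zero_le _)
      (Finset.mem_univ i))
    by_cases h : T₁.graph = ∅
    · refine le_max_of_le_right (ih₂ (fun h2 => hT ?_) _ ⟨_, hj.2⟩)
      simp [JoinTree.graph, h, h2]
    · exact le_max_of_le_left (ih₁ h _ ⟨_, hj.1⟩)

theorem subset_graph_of_mem_branch (T : JoinTree) :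
    ∀ b ∈ T.branches, ∀ G ∈ b, G ⊆ T.graph := by
  induction T with
  | leaf G => simp [JoinTree.branches, JoinTree.graph]
  | node T₁ T₂ ih₁ ih₂ =>
    simp only [JoinTree.branches, JoinTree.graph, List.mem_append, List.mem_map]
    rintro b (⟨b, hb, rfl⟩ | ⟨b, hb, rfl⟩) G hG <;> rcases List.mem_cons.1 hG with rfl | hG
    · exact Finset.subset_union_right
    · exact (ih₁ b hb G hG).trans Finset.subset_union_left
    · exact Finset.subset_union_left
    · exact (ih₂ b hb G hG).trans Finset.subset_union_right

theorem branches_ne_nil (T : JoinTree) : T.branches ≠ [] := by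
  induction T with
  | leaf G => simp [JoinTree.branches]
  | node T₁ T₂ ih₁ ih₂ => simp [JoinTree.branches, ih₁]

/-- `X` is covered by at most `m` sets, each bounded by pathsets over the graphs in `L`. -/
def HasBoundedCover (n ntil k : ℕ) (L : List PGraph) (X : Set (ℤ → Fin n)) (m : ℕ) : Prop :=
  ∃ 𝒳 : Finset (Set (ℤ → Fin n)), 𝒳.card ≤ m ∧ (∀ Y ∈ 𝒳, PathsetBounded n ntil k L Y) ∧
    ∀ γ ∈ X, ∃ Y ∈ 𝒳, γ ∈ Y

theorem HasBoundedCover.iUnion {n ntil k r : ℕ} {L : List PGraph}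
    {X : Fin r → Set (ℤ → Fin n)} {m : Fin r → ℕ}
    (h : ∀ i, HasBoundedCover n ntil k L (X i) (m i)) :
    HasBoundedCover n ntil k L (⋃ i, X i) (∑ i, m i) := by
  choose 𝒳 h1 h2 h3 using h
  refine ⟨Finset.univ.biUnion 𝒳,
    Finset.card_biUnion_le.trans (Finset.sum_le_sum fun i _ => h1 i), fun Y hY => ?_,
    fun γ hγ => ?_⟩
  · obtain ⟨i, -, hi⟩ := Finset.mem_biUnion.1 hY
    exact h2 i Y hi
  · obtain ⟨i, hi⟩ := Set.mem_iUnion.1 hγ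
    obtain ⟨Y, hY, hγY⟩ := h3 i γ hi
    exact ⟨Y, Finset.mem_biUnion.2 ⟨i, Finset.mem_univ _, hY⟩, hγY⟩

theorem HasBoundedCover.mono {n ntil k m m' : ℕ} {L : List PGraph}
    {X X' : Set (ℤ → Fin n)} (h : HasBoundedCover n ntil k L X m) (hX : X' ⊆ X)
    (hm : m ≤ m') : HasBoundedCover n ntil k L X' m' := by
  obtain ⟨𝒳, h1, h2, h3⟩ := h
  exact ⟨𝒳, h1.trans hm, h2, fun γ hγ => h3 γ (hX hγ)⟩

theorem HasBoundedCover.cons {n ntil k m : ℕ} {L : List PGraph} {X : Set (ℤ → Fin n)}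
    (h : HasBoundedCover n ntil k L X m) {G : PGraph} {D : Finset (↥(verts G) → Fin n)}
    (hD : IsPathset n ntil k G D) :
    HasBoundedCover n ntil k (G :: L) (X ∩ cylinder n G D) m := by
  obtain ⟨𝒳, h1, h2, h3⟩ := h
  refine ⟨𝒳.image (· ∩ cylinder n G D), Finset.card_image_le.trans h1, fun Y hY => ?_,
    fun γ hγ => ?_⟩
  · obtain ⟨Z, hZ, rfl⟩ := Finset.mem_image.1 hY
    intro H hH
    rcases List.mem_cons.1 hH with rfl | hH
    · exact ⟨D, hD, Set.inter_subset_right⟩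
    · obtain ⟨E, hE, hZE⟩ := h2 Z hZ H hH
      exact ⟨E, hE, Set.inter_subset_left.trans hZE⟩
  · obtain ⟨Y, hY, hγY⟩ := h3 γ hγ.1
    exact ⟨_, Finset.mem_image_of_mem _ hY, hγY, hγ.2⟩

theorem hasBoundedCover_inter_cylinder {n ntil k : ℕ} (hntil : 0 < ntil) (hle : ntil ≤ n)
    {T S : JoinTree} (hne : T.graph ∪ S.graph ≠ ∅) {b : List PGraph} (hb : b ∈ T.branches)
    {B : Finset (↥(verts T.graph) → Fin n)} {C : Finset (↥(verts S.graph) → Fin n)}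
    (hB : IsPathset n ntil k T.graph B) (hC : IsPathset n ntil k S.graph C)
    (ih : T.graph ≠ ∅ →
      HasBoundedCover n ntil k b (cylinder n T.graph B) (chi n ntil k T B)) :
    HasBoundedCover n ntil k (S.graph :: b) (cylinder n T.graph B ∩ cylinder n S.graph C)
      (max (chi n ntil k T B) (chi n ntil k S C)) := by
  by_cases hT : T.graph = ∅
  · rcases C.eq_empty_or_nonempty with rfl | hCne
    · exact ⟨∅, by simp, by simp, by simp [cylinder]⟩
    · have hS : S.graph ≠ ∅ := fun h => hne (by simp [hT, h])
      have h1 := one_le_chi k hntil hle S hS C hCne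
      have hcov : HasBoundedCover n ntil k b (cylinder n T.graph B) 1 := by
        refine ⟨{cylinder n T.graph B}, by simp, ?_, by simp⟩
        simp only [Finset.mem_singleton, forall_eq]
        intro G hG
        have hGT : G = T.graph :=
          (Finset.subset_empty.1 (hT ▸ subset_graph_of_mem_branch T b hb G hG)).trans hT.symm
        subst hGT
        exact ⟨B, hB, subset_rfl⟩
      exact (hcov.cons hC).mono subset_rfl (le_max_of_le_right h1)
  · exact ((ih hT).cons hC).mono subset_rfl (le_max_left _ _)

theorem hasBoundedCover_chi {n ntil k : ℕ} (hntil : 0 < ntil) (hle : ntil ≤ n)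
    (T : JoinTree) (hT : T.graph ≠ ∅) (b : List PGraph) (hb : b ∈ T.branches)
    (A : Finset (↥(verts T.graph) → Fin n)) (hA : IsPathset n ntil k T.graph A) :
    HasBoundedCover n ntil k b (cylinder n T.graph A) (chi n ntil k T A) := by
  induction T generalizing b with
  | leaf G =>
    have hG : G ≠ ∅ := hT
    rcases A.eq_empty_or_nonempty with rfl | hne
    · exact ⟨∅, by simp, by simp, by simp [cylinder]⟩
    · obtain rfl : b = [G] := by simpa [JoinTree.branches] using hb
      refine ⟨{cylinder n G A}, by simp [chi, hG, hne.ne_empty], ?_, by simp [JoinTree.graph]⟩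
      simp only [Finset.mem_singleton, forall_eq, PathsetBounded, List.mem_singleton]
      exact ⟨A, hA, subset_rfl⟩
  | node T₁ T₂ ih₁ ih₂ =>
    obtain ⟨r, Ai, Bi, Ci, -, hB, hC, hJ, hcov, hchi⟩ := chi_node_witness k hntil hle T₁ T₂ A
    have hsub : cylinder n (T₁.graph ∪ T₂.graph) A ⊆
        ⋃ i, cylinder n T₁.graph (Bi i) ∩ cylinder n T₂.graph (Ci i) := by
      intro γ hγ
      obtain ⟨i, -, hi⟩ := Finset.mem_biUnion.1 (hcov hγ)
      exact Set.mem_iUnion.2 ⟨i, (Finset.mem_filter.1 (hJ i hi)).2⟩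
    rw [hchi]
    refine HasBoundedCover.mono (HasBoundedCover.iUnion fun i => ?_) hsub le_rfl
    simp only [JoinTree.branches, List.mem_append, List.mem_map] at hb
    have hne : T₁.graph ∪ T₂.graph ≠ ∅ := hT
    rcases hb with ⟨b, hb, rfl⟩ | ⟨b, hb, rfl⟩
    · exact hasBoundedCover_inter_cylinder hntil hle hne hb (hB i) (hC i)
        fun h => ih₁ h b hb _ (hB i)
    · rw [Set.inter_comm, max_comm]
      exact hasBoundedCover_inter_cylinder hntil hle (by rwa [Finset.union_comm]) hb (hC i)
        (hB i) fun h => ih₂ h b hb _ (hC i)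

theorem restrict_injOn_agreeOff {n : ℕ} {U W : Finset ℤ} (hUW : U ⊆ W) (γ₀ : ℤ → Fin n) :
    Set.InjOn (fun (γ : ℤ → Fin n) (v : ↥W) => γ v.1) (agreeOff U γ₀) := by
  intro γ hγ δ hδ h
  funext v
  by_cases hv : v ∈ W
  · exact congrFun h ⟨v, hv⟩
  · rw [hγ v (fun h => hv (hUW h)), hδ v (fun h => hv (hUW h))]

theorem finite_agreeOff {n : ℕ} (U : Finset ℤ) (γ₀ : ℤ → Fin n) : (agreeOff U γ₀).Finite :=
  Set.Finite.of_injOn (Set.mapsTo_univ _ _) (restrict_injOn_agreeOff subset_rfl γ₀)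
    Set.finite_univ

theorem ncard_agreeOff_le {n : ℕ} (U : Finset ℤ) (γ₀ : ℤ → Fin n) :
    (agreeOff U γ₀).ncard ≤ n ^ U.card := by
  refine (Set.ncard_le_ncard_of_injOn _ (fun _ _ => Set.mem_univ _)
    (restrict_injOn_agreeOff subset_rfl γ₀) Set.finite_univ).trans ?_
  simp [Set.ncard_univ]

theorem ncard_agreeOff_inter_cylinder_le {n ntil k : ℕ} (hn : 0 < n) {G F : PGraph}
    {D : Finset (↥(verts G) → Fin n)} (hD : IsPathset n ntil k G D) (hF : F ⊆ pathk k)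
    (γ₀ : ℤ → Fin n) :
    ((agreeOff (verts G \ verts F) γ₀ ∩ cylinder n G D).ncard : ℝ) ≤
      (1 / (ntil : ℝ)) ^ Delta (ominus G F) * (n : ℝ) ^ (verts G \ verts F).card := by
  have hn' : (0 : ℝ) < n := by exact_mod_cast hn
  rw [← div_le_iff₀ (by positivity)]
  refine le_trans ?_ ((le_ciSup (Set.finite_range _).bddAbove
    (fun v : ↥(verts F) => γ₀ v.1)).trans (hD F hF))
  gcongr
  rw [← Set.ncard_coe_finset]
  refine Set.ncard_le_ncard_of_injOn _ (fun γ hγ => ?_)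
    ((restrict_injOn_agreeOff Finset.sdiff_subset γ₀).mono Set.inter_subset_left)
    (Finset.finite_toSet _)
  simp only [Finset.coe_filter, Set.mem_ofPred_eq]
  exact ⟨hγ.2, fun v hG hF => hγ.1 v (by simp [hF])⟩

theorem ncard_le_mul_of_fiber_le {α β : Type*} {S : Set α} {S' : Set β} (hS : S.Finite)
    (hS' : S'.Finite) {f : α → β} (hf : Set.MapsTo f S S') {M : ℝ}
    (hM : ∀ y ∈ S', (({x ∈ S | f x = y} : Set α).ncard : ℝ) ≤ M) :
    (S.ncard : ℝ) ≤ S'.ncard * M := by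
  rw [Set.ncard_eq_toFinset_card S hS, Set.ncard_eq_toFinset_card S' hS',
    Finset.card_eq_sum_card_fiberwise (f := f) (t := hS'.toFinset) (by simpa using hf)]
  push_cast
  rw [← nsmul_eq_mul]
  refine Finset.sum_le_card_nsmul _ _ _ fun y hy => ?_
  refine le_trans (le_of_eq ?_) (hM y (by simpa using hy))
  rw [← Set.ncard_coe_finset]
  simp

theorem ncard_agreeOff_inter_le {n ntil k : ℕ} (hn : 0 < n) (V : Finset ℤ)
    {X : Set (ℤ → Fin n)} (L : List PGraph) (hL : ∀ G ∈ L, G ⊆ pathk k ∧ verts G ⊆ V)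
    (hX : PathsetBounded n ntil k L X) (F : PGraph) (hF : F ⊆ pathk k) (γ₀ : ℤ → Fin n) :
    ((agreeOff (V \ verts F) γ₀ ∩ X).ncard : ℝ) ≤
      (1 / (ntil : ℝ)) ^ dvecFrom F L * (n : ℝ) ^ (V \ verts F).card := by
  induction L generalizing F γ₀ with
  | nil =>
    simp only [dvecFrom, pow_zero, one_mul]
    exact_mod_cast (Set.ncard_le_ncard Set.inter_subset_left (finite_agreeOff _ _)).trans
      (ncard_agreeOff_le _ _)
  | cons G L ih =>
    obtain ⟨D, hD, hXD⟩ := hX G List.mem_cons_self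
    obtain ⟨hGk, hGV⟩ := hL G List.mem_cons_self
    have ih' := ih (fun H hH => hL H (List.mem_cons_of_mem _ hH))
      (fun H hH => hX H (List.mem_cons_of_mem _ hH)) (F ∪ G) (Finset.union_subset hF hGk)
    have hcard : (V \ verts F).card =
        (verts G \ verts F).card + (V \ verts (F ∪ G)).card := by
      rw [← Finset.card_union_of_disjoint]
      · congr 1
        ext v
        have := @hGV v
        simp only [verts_union, Finset.mem_sdiff, Finset.mem_union]
        tauto
      · rw [Finset.disjoint_left]
        intro v
        simp only [verts_union, Finset.mem_sdiff, Finset.mem_union]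
        tauto
    let φ : (ℤ → Fin n) → ℤ → Fin n := fun γ v =>
      if v ∈ verts G \ verts F then γ v else γ₀ v
    have key := ncard_le_mul_of_fiber_le (S := agreeOff (V \ verts F) γ₀ ∩ X)
      (S' := agreeOff (verts G \ verts F) γ₀ ∩ cylinder n G D) (f := φ)
      ((finite_agreeOff _ _).inter_of_left _) ((finite_agreeOff _ _).inter_of_left _)
      (M := (1 / (ntil : ℝ)) ^ dvecFrom (F ∪ G) L * (n : ℝ) ^ (V \ verts (F ∪ G)).card) ?_ ?_
    · refine key.trans ((mul_le_mul_of_nonneg_right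
        (ncard_agreeOff_inter_cylinder_le hn hD hF γ₀) (by positivity)).trans_eq ?_)
      rw [hcard, dvecFrom, pow_add, pow_add]
      ring
    · rintro γ ⟨hγ, hγX⟩
      refine ⟨fun v hv => if_neg hv, ?_⟩
      have : (fun v : ↥(verts G) => φ γ v.1) = fun v : ↥(verts G) => γ v.1 := by
        funext v
        by_cases hv : v.1 ∈ verts G \ verts F
        · exact if_pos hv
        · refine (if_neg hv).trans (hγ v.1 fun h => hv ?_).symm
          exact Finset.mem_sdiff.2 ⟨v.2, (Finset.mem_sdiff.1 h).2⟩
      change (fun v : ↥(verts G) => φ γ v.1) ∈ D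
      rw [this]
      exact hXD hγX
    · rintro δ -
      refine le_trans ?_ (ih' δ)
      gcongr
      · exact (finite_agreeOff _ _).inter_of_left _
      rintro γ ⟨⟨hγ, hγX⟩, rfl⟩
      refine ⟨fun v hv => ?_, hγX⟩
      by_cases hv' : v ∈ verts G \ verts F
      · exact (if_pos hv').symm
      · refine (hγ v fun h => hv ?_).trans (if_neg hv').symm
        simp only [verts_union, Finset.mem_sdiff, Finset.mem_union] at h hv' ⊢
        tauto

theorem pow_dvec_mul_mu_le_chi {n ntil k : ℕ} (hn : 0 < n) (hntil : 0 < ntil) (hk : 0 < k)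
    (hle : ntil ≤ n) (T : JoinTree) (hroot : T.graph = pathk k)
    (A : Finset (↥(verts T.graph) → Fin n)) (hA : IsPathset n ntil k T.graph A)
    {b : List PGraph} (hb : b ∈ T.branches) {L : List PGraph} (hL : ∀ G ∈ L, G ∈ b) :
    (ntil : ℝ) ^ dvec L * mu n T.graph A ≤ (chi n ntil k T A : ℝ) := by
  have hn' : (0 : ℝ) < n := by exact_mod_cast hn
  have hntil' : (0 : ℝ) < ntil := by exact_mod_cast hntil
  have hT : T.graph ≠ ∅ := by
    rw [hroot, pathk, Ne, Finset.Icc_eq_empty_iff]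
    omega
  obtain ⟨𝒳, hcard, hbd, hcov⟩ := hasBoundedCover_chi hntil hle T hT b hb A hA
  let γ₀ : ℤ → Fin n := fun _ => ⟨0, hn⟩
  let ext : (↥(verts T.graph) → Fin n) → ℤ → Fin n := fun α v => if h : v ∈ verts T.graph then α ⟨v, h⟩ else γ₀ v
  have hres : ∀ α, (fun v : ↥(verts T.graph) => ext α v.1) = α := fun α => by
    funext v
    simp [ext]
  have hinj : Function.Injective ext := fun α β h => by
    rw [← hres α, ← hres β, h]
  have hX : ∀ Y ∈ 𝒳, ((agreeOff (verts T.graph) γ₀ ∩ Y).ncard : ℝ) ≤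
      (1 / (ntil : ℝ)) ^ dvec L * (n : ℝ) ^ (verts T.graph).card := by
    intro Y hY
    have h := ncard_agreeOff_inter_le hn (verts T.graph) L
      (fun G hG => by
        have := subset_graph_of_mem_branch T b hb G (hL G hG)
        exact ⟨hroot ▸ this, verts_mono this⟩)
      (fun G hG => hbd Y hY G (hL G hG)) ∅ (Finset.empty_subset _) γ₀
    rw [verts_empty, Finset.sdiff_empty] at h
    exact h
  have hAcard : A.card ≤ ∑ Y ∈ 𝒳, (agreeOff (verts T.graph) γ₀ ∩ Y).ncard := by
    refine le_trans ?_ (Finset.set_ncard_biUnion_le 𝒳 fun Y => agreeOff (verts T.graph) γ₀ ∩ Y)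
    rw [← Set.ncard_coe_finset]
    refine Set.ncard_le_ncard_of_injOn ext (fun α hα => ?_) hinj.injOn
      (𝒳.finite_toSet.biUnion fun Y _ => (finite_agreeOff _ _).inter_of_left _)
    obtain ⟨Y, hY, hαY⟩ := hcov (ext α) (by
      change (fun v : ↥(verts T.graph) => ext α v.1) ∈ A
      rw [hres]
      exact hα)
    exact Set.mem_biUnion hY ⟨fun v hv => dif_neg hv, hαY⟩
  have hA' : (A.card : ℝ) ≤
      (chi n ntil k T A : ℝ) * ((1 / (ntil : ℝ)) ^ dvec L * (n : ℝ) ^ (verts T.graph).card) := by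
    calc (A.card : ℝ) ≤ ∑ Y ∈ 𝒳, ((agreeOff (verts T.graph) γ₀ ∩ Y).ncard : ℝ) := by exact_mod_cast hAcard
      _ ≤ 𝒳.card • ((1 / (ntil : ℝ)) ^ dvec L * (n : ℝ) ^ (verts T.graph).card) :=
        Finset.sum_le_card_nsmul _ _ _ hX
      _ ≤ _ := by
        rw [nsmul_eq_mul]
        gcongr
  calc (ntil : ℝ) ^ dvec L * mu n T.graph A
      ≤ (ntil : ℝ) ^ dvec L * ((chi n ntil k T A : ℝ) *
        ((1 / (ntil : ℝ)) ^ dvec L * (n : ℝ) ^ (verts T.graph).card) / (n : ℝ) ^ (verts T.graph).card) := by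
        unfold mu
        gcongr
    _ = _ := by
        rw [one_div_pow]
        field_simp

theorem foldr_max_zero_mem {l : List ℕ} (hl : l ≠ []) : l.foldr max 0 ∈ l := by
  induction l with
  | nil => exact absurd rfl hl
  | cons a l ih =>
    rcases eq_or_ne l [] with rfl | h
    · simp
    · rw [List.foldr_cons]
      rcases max_choice a (l.foldr max 0) with h' | h' <;> rw [h']
      · exact List.mem_cons_self
      · exact List.mem_cons_of_mem _ (ih h)

theorem exists_branch_dvec_eq_Psi (T : JoinTree) :
    ∃ b ∈ T.branches, ∃ L : List PGraph, (∀ G ∈ L, G ∈ b) ∧ dvec L = Psi T := by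
  obtain ⟨b, hb, hbeq⟩ := List.mem_map.1 (foldr_max_zero_mem
    (l := T.branches.map fun b => ((b.dedup.permutations).map dvec).foldr max 0)
    (by simpa using branches_ne_nil T))
  obtain ⟨L, hL, hLeq⟩ := List.mem_map.1 (foldr_max_zero_mem
    (l := (b.dedup.permutations).map dvec)
    (List.ne_nil_of_mem (List.mem_map_of_mem (List.mem_permutations.2 (List.Perm.refl _)))))
  exact ⟨b, hb, L, fun G hG => List.mem_dedup.1 ((List.mem_permutations.1 hL).subset hG),
    hLeq.trans hbeq⟩

/-- **Lemma 6.8.**  For every `Path_k`-join tree `T` and every `Path_k`-pathset `A`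
(with respect to `n` and `ñ`), `χ_T(A) ≥ ñ^{Ψ(T)} · μ(A)`. -/
theorem pathset_complexity_psi_bound (n ntil k : ℕ) (hn : 0 < n) (hntil : 0 < ntil)
    (hk : 0 < k) (hle : ntil ≤ n) (T : JoinTree) (hval : T.valid) (hroot : T.graph = pathk k)
    (A : Finset (↥(verts T.graph) → Fin n)) (hA : IsPathset n ntil k T.graph A) :
    (ntil : ℝ) ^ Psi T * mu n T.graph A ≤ (chi n ntil k T A : ℝ) := by
  obtain ⟨b, hb, L, hL, hPsi⟩ := exists_branch_dvec_eq_Psi T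
  rw [← hPsi]
  exact pow_dvec_mul_mu_le_chi hn hntil hk hle T hroot A hA hb hL
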